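/- There exists a constant C depending only on k such that for every (k+2)-times continuously differentiable u on [a,b] and every element τ_i, the truncated Jacobi projection u_I satisfies |(u-u_I)''(g_{in})| ≤ C h^{k} |u|_{k+2,∞,τ_i} at each of the k-1 Gauss points g_{in} of τ_i. -/

import Mathlib

open Set Finset intervalIntegral

/-- The Legendre polynomial of degree `n` (Rodrigues formula), as a real function. -/
noncomputable def legendre (n : ℕ) : ℝ → ℝ :=
  fun s => (1 / ((2 : ℝ) ^ n * n.factorial)) * iteratedDeriv n (fun t : ℝ => (t ^ 2 - 1) ^ n) s

/-- The affine map sending `[-1,1]` onto `[p,q]`. -/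
noncomputable def affMap (p q s : ℝ) : ℝ := (p + q) / 2 + s * (q - p) / 2

/-- `x 0 = a < x 1 < ... < x N = b` is a partition of `[a,b]`. -/
def IsMesh (a b : ℝ) (N : ℕ) (x : ℕ → ℝ) : Prop :=
  1 ≤ N ∧ x 0 = a ∧ x N = b ∧ ∀ i < N, x i < x (i + 1)

/-- `h` is the maximal element length `h = max_i (x i - x (i-1))`. -/
def IsMeshSize (N : ℕ) (x : ℕ → ℝ) (h : ℝ) : Prop :=
  (∀ i ∈ Finset.Icc 1 N, x i - x (i - 1) ≤ h) ∧ ∃ i ∈ Finset.Icc 1 N, x i - x (i - 1) = h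

/-- Quasi-uniformity with constant `c`: `h ≤ c · h_i` for all elements. -/
def IsQuasiUniform (N : ℕ) (x : ℕ → ℝ) (h c : ℝ) : Prop :=
  ∀ i ∈ Finset.Icc 1 N, h ≤ c * (x i - x (i - 1))

/-- `P i` are the element polynomials (degree ≤ k) of a member of `V_h^0`:
a C¹ piecewise polynomial vanishing at both ends of `[a,b]`. -/
def IsVh0 (k N : ℕ) (x : ℕ → ℝ) (P : ℕ → Polynomial ℝ) : Prop :=
  (∀ i ∈ Finset.Icc 1 N, (P i).natDegree ≤ k) ∧
  (∀ i ∈ Finset.Icc 1 (N - 1), (P i).eval (x i) = (P (i + 1)).eval (x i)) ∧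
  (∀ i ∈ Finset.Icc 1 (N - 1),
      (Polynomial.derivative (P i)).eval (x i) = (Polynomial.derivative (P (i + 1))).eval (x i)) ∧
  (P 1).eval (x 0) = 0 ∧ (P N).eval (x N) = 0

/-- `P i` are the element polynomials of a Petrov–Galerkin solution `u_h ∈ V_h^0`:
`∑_i ∫_{τ_i} (-α u_h'' + β u_h' + γ u_h) v_h = ∫_a^b f v_h` for all `v_h ∈ W_h`. -/
def IsPGSol (k N : ℕ) (x : ℕ → ℝ) (α β γ : ℝ) (f : ℝ → ℝ) (P : ℕ → Polynomial ℝ) : Prop :=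
  IsVh0 k N x P ∧
  ∀ Q : ℕ → Polynomial ℝ, (∀ i ∈ Finset.Icc 1 N, (Q i).natDegree ≤ k - 2) →
    (∑ i ∈ Finset.Icc 1 N, ∫ t in (x (i - 1))..(x i),
        (-α * ((Polynomial.derivative (Polynomial.derivative (P i))).eval t)
            + β * ((Polynomial.derivative (P i)).eval t) + γ * (P i).eval t) * (Q i).eval t)
      = ∑ i ∈ Finset.Icc 1 N, ∫ t in (x (i - 1))..(x i), f t * (Q i).eval t

/-- `P i` are the element polynomials of a Gauss collocation solution `ū_h ∈ V_h^0`: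
`(-α ū_h'' + β ū_h' + γ ū_h)(g) = f(g)` at every Gauss point `g` of every element. -/
def IsGaussSol (k N : ℕ) (x : ℕ → ℝ) (α β γ : ℝ) (f : ℝ → ℝ) (P : ℕ → Polynomial ℝ) : Prop :=
  IsVh0 k N x P ∧
  ∀ i ∈ Finset.Icc 1 N, ∀ s ∈ Set.Ioo (-1 : ℝ) 1, legendre (k - 1) s = 0 →
    -α * ((Polynomial.derivative (Polynomial.derivative (P i))).eval (affMap (x (i - 1)) (x i) s))
        + β * ((Polynomial.derivative (P i)).eval (affMap (x (i - 1)) (x i) s))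
        + γ * (P i).eval (affMap (x (i - 1)) (x i) s)
      = f (affMap (x (i - 1)) (x i) s)

/-- `p` is the elementwise truncated Jacobi projection of `u` on the element `[xl, xr]`:
the polynomial of degree ≤ k matching `u` and `u'` at both endpoints with
`(u - p)'' ⊥ P_{k-2}` in `L²(xl, xr)`. -/
def IsElemProj (k : ℕ) (u : ℝ → ℝ) (xl xr : ℝ) (p : Polynomial ℝ) : Prop :=
  p.natDegree ≤ k ∧ p.eval xl = u xl ∧ p.eval xr = u xr ∧
  (Polynomial.derivative p).eval xl = deriv u xl ∧
  (Polynomial.derivative p).eval xr = deriv u xr ∧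
  ∀ q : Polynomial ℝ, q.natDegree ≤ k - 2 →
    (∫ t in xl..xr,
        (iteratedDeriv 2 u t - (Polynomial.derivative (Polynomial.derivative p)).eval t)
          * q.eval t) = 0

/-- The `n`-th derivative of `(X ^ 2 - 1) ^ n`, a nonzero multiple of the Legendre polynomial. -/
noncomputable def rodriguesPoly (n : ℕ) : Polynomial ℝ :=
  Polynomial.derivative^[n] ((Polynomial.X ^ 2 - 1) ^ n)

theorem iteratedDeriv_polynomial_eval (p : Polynomial ℝ) (n : ℕ) :
    iteratedDeriv n (fun t => p.eval t) = fun t => (Polynomial.derivative^[n] p).eval t := by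
  induction n with
  | zero => simp
  | succ n ih =>
    rw [iteratedDeriv_succ, ih, Function.iterate_succ_apply']
    ext t
    exact Polynomial.deriv _

theorem legendre_eq_zero_iff (n : ℕ) (s : ℝ) :
    legendre n s = 0 ↔ (rodriguesPoly n).eval s = 0 := by
  have h := congrFun (iteratedDeriv_polynomial_eval ((Polynomial.X ^ 2 - 1) ^ n) n) s
  simp only [Polynomial.eval_pow, Polynomial.eval_sub, Polynomial.eval_X,
    Polynomial.eval_one] at h
  unfold legendre rodriguesPoly
  rw [h, mul_eq_zero, or_iff_right]
  positivity

theorem natDegree_X_sq_sub_one_pow (n : ℕ) :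
    ((Polynomial.X ^ 2 - 1 : Polynomial ℝ) ^ n).natDegree = 2 * n := by
  have : (Polynomial.X ^ 2 - 1 : Polynomial ℝ).natDegree = 2 := by compute_degree!
  rw [Polynomial.natDegree_pow, this, mul_comm]

theorem natDegree_rodriguesPoly_le (n : ℕ) : (rodriguesPoly n).natDegree ≤ n := by
  refine (Polynomial.natDegree_iterate_derivative _ _).trans ?_
  rw [natDegree_X_sq_sub_one_pow]
  omega

theorem rodriguesPoly_ne_zero (n : ℕ) : rodriguesPoly n ≠ 0 := by
  intro h
  have hc := congrArg (fun p : Polynomial ℝ => p.coeff n) h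
  simp only [rodriguesPoly, Polynomial.coeff_iterate_derivative, Polynomial.coeff_zero] at hc
  have hne : ((Polynomial.X ^ 2 - 1 : Polynomial ℝ) ^ n) ≠ 0 := by
    apply pow_ne_zero
    intro h0
    have := congrArg (fun p : Polynomial ℝ => p.eval 0) h0
    simp at this
  have hlead : ((Polynomial.X ^ 2 - 1 : Polynomial ℝ) ^ n).coeff (n + n) ≠ 0 := by
    rw [← two_mul, ← natDegree_X_sq_sub_one_pow]
    exact Polynomial.leadingCoeff_ne_zero.mpr hne
  rw [nsmul_eq_mul, mul_eq_zero] at hc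
  rcases hc with hc | hc
  · rw [Nat.cast_eq_zero, Nat.descFactorial_eq_zero_iff_lt] at hc
    omega
  · exact hlead hc

theorem eval_iterate_derivative_X_sq_sub_one_pow {n j : ℕ} (hj : j < n) {t : ℝ}
    (ht : t ^ 2 = 1) :
    (Polynomial.derivative^[j] ((Polynomial.X ^ 2 - 1 : Polynomial ℝ) ^ n)).eval t = 0 := by
  obtain ⟨q, hq⟩ :=
    Polynomial.pow_sub_dvd_iterate_derivative_pow (Polynomial.X ^ 2 - 1 : Polynomial ℝ) n j
  rw [hq]
  simp [ht, Nat.sub_ne_zero_of_lt hj]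

theorem integral_add_of_continuous {f g : ℝ → ℝ} (hf : Continuous f) (hg : Continuous g)
    (a b : ℝ) : ∫ t in a..b, f t + g t = (∫ t in a..b, f t) + ∫ t in a..b, g t :=
  integral_add (hf.intervalIntegrable a b) (hg.intervalIntegrable a b)

theorem integral_iterate_derivative_mul_eq_zero (n : ℕ) :
    ∀ j ≤ n, ∀ S : Polynomial ℝ, S.natDegree < j →
      ∫ t in (-1 : ℝ)..1,
        (Polynomial.derivative^[j] ((Polynomial.X ^ 2 - 1) ^ n)).eval t * S.eval t = 0 := by
  intro j
  induction j with
  | zero => intro _ S hS; omega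
  | succ j ih =>
    intro hj S hS
    set P := Polynomial.derivative^[j] ((Polynomial.X ^ 2 - 1 : Polynomial ℝ) ^ n) with hP
    have h1 : P.eval 1 = 0 := eval_iterate_derivative_X_sq_sub_one_pow (by omega) (by norm_num)
    have h2 : P.eval (-1) = 0 := eval_iterate_derivative_X_sq_sub_one_pow (by omega) (by norm_num)
    have hparts := integral_deriv_mul_eq_sub (a := (-1 : ℝ)) (b := 1)
      (u := fun t => P.eval t) (v := fun t => S.eval t)
      (u' := fun t => P.derivative.eval t) (v' := fun t => S.derivative.eval t)
      (fun t _ => P.hasDerivAt t) (fun t _ => S.hasDerivAt t)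
      (P.derivative.continuous.intervalIntegrable _ _)
      (S.derivative.continuous.intervalIntegrable _ _)
    rw [h1, h2, integral_add_of_continuous (by fun_prop) (by fun_prop)] at hparts
    have hz : ∫ t in (-1 : ℝ)..1, P.eval t * S.derivative.eval t = 0 := by
      rcases Nat.eq_zero_or_pos S.natDegree with h0 | h0
      · rw [Polynomial.derivative_of_natDegree_zero h0]
        simp
      · have := Polynomial.natDegree_derivative_lt h0.ne'
        exact ih (by omega) _ (by omega)
    rw [Function.iterate_succ_apply', ← hP]
    linarith

theorem integral_rodriguesPoly_mul_eq_zero {n : ℕ} {S : Polynomial ℝ} (hS : S.natDegree < n) :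
    ∫ t in (-1 : ℝ)..1, (rodriguesPoly n).eval t * S.eval t = 0 :=
  integral_iterate_derivative_mul_eq_zero n n le_rfl S hS

theorem exists_eq_C_add_X_sub_C_mul (D : Polynomial ℝ) (s : ℝ) {n : ℕ} (hn : 1 ≤ n)
    (hD : D.natDegree ≤ n) :
    ∃ S : Polynomial ℝ, S.natDegree < n ∧
      ∀ t, D.eval t = D.eval s + (t - s) * S.eval t := by
  refine ⟨D /ₘ (Polynomial.X - Polynomial.C s), ?_, fun t => ?_⟩
  · rw [Polynomial.natDegree_divByMonic _ (Polynomial.monic_X_sub_C s),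
      Polynomial.natDegree_X_sub_C]
    omega
  · have := congrArg (Polynomial.eval t)
      (Polynomial.modByMonic_add_div D (Polynomial.X - Polynomial.C s))
    rw [Polynomial.modByMonic_X_sub_C_eq_C_eval] at this
    simpa using this.symm

/-- Gauss quadrature with the nodal polynomial of the root `s`: integration against it extracts
the value at `s` of any polynomial of degree at most `n`. -/
theorem integral_mul_nodal {n : ℕ} (hn : 1 ≤ n) {s : ℝ} {l : Polynomial ℝ}
    (hl : ∀ t, (rodriguesPoly n).eval t = (t - s) * l.eval t) {D : Polynomial ℝ}
    (hD : D.natDegree ≤ n) :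
    ∫ t in (-1 : ℝ)..1, D.eval t * l.eval t = D.eval s * ∫ t in (-1 : ℝ)..1, l.eval t := by
  obtain ⟨S, hS, hDS⟩ := exists_eq_C_add_X_sub_C_mul D s hn hD
  have heq : ∀ t, D.eval t * l.eval t
      = D.eval s * l.eval t + (rodriguesPoly n).eval t * S.eval t := by
    intro t
    rw [hDS t, hl t]
    ring
  simp_rw [heq]
  rw [integral_add_of_continuous (by fun_prop) (by fun_prop),
    integral_rodriguesPoly_mul_eq_zero hS, integral_const_mul, add_zero]

theorem integral_eval_sq_pos {l : Polynomial ℝ} (hl : l ≠ 0) :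
    0 < ∫ t in (-1 : ℝ)..1, l.eval t * l.eval t := by
  have hex : ∃ c ∈ Set.Icc (-1 : ℝ) 1, l.eval c ≠ 0 := by
    by_contra! h
    exact hl (Polynomial.eq_zero_of_infinite_isRoot l
      ((Set.Icc_infinite (by norm_num : (-1 : ℝ) < 1)).mono h))
  obtain ⟨c, hc, hlc⟩ := hex
  exact integral_pos (by norm_num) (l.continuous.mul l.continuous).continuousOn
    (fun t _ => mul_self_nonneg _) ⟨c, hc, mul_self_pos.mpr hlc⟩

theorem exists_bound_at_root {n : ℕ} (hn : 1 ≤ n) {s : ℝ} (hs : (rodriguesPoly n).eval s = 0) :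
    ∃ K : ℝ, 0 ≤ K ∧ ∀ D : Polynomial ℝ, D.natDegree ≤ n → ∀ R : ℝ → ℝ, Continuous R →
      ∀ B : ℝ, (∀ t ∈ Set.Ioo (-1 : ℝ) 1, |R t| ≤ B) →
      (∀ q : Polynomial ℝ, q.natDegree < n →
        ∫ t in (-1 : ℝ)..1, (D.eval t + R t) * q.eval t = 0) →
      |D.eval s| ≤ K * B := by
  obtain ⟨l, hldeg, hl⟩ :=
    exists_eq_C_add_X_sub_C_mul _ s hn (natDegree_rodriguesPoly_le n)
  simp only [hs, zero_add] at hl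
  have hl0 : l ≠ 0 := by
    rintro rfl
    exact rodriguesPoly_ne_zero n (Polynomial.funext fun t => by simp [hl t])
  have hI : (∫ t in (-1 : ℝ)..1, l.eval t) ≠ 0 := by
    intro h0
    have h1 := integral_mul_nodal hn hl hldeg.le
    rw [h0, mul_zero] at h1
    exact (integral_eval_sq_pos hl0).ne' h1
  set I := ∫ t in (-1 : ℝ)..1, l.eval t with hIdef
  set J := ∫ t in (-1 : ℝ)..1, |l.eval t| with hJdef
  have hJ : 0 ≤ J := integral_nonneg (by norm_num) fun t _ => abs_nonneg _
  refine ⟨J / |I|, by positivity, fun D hD R hR B hB horth => ?_⟩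
  have h1 := horth l hldeg
  simp_rw [add_mul] at h1
  rw [integral_add_of_continuous (by fun_prop) (by fun_prop), integral_mul_nodal hn hl hD,
    ← hIdef] at h1
  have h2 : |∫ t in (-1 : ℝ)..1, R t * l.eval t| ≤ B * J := by
    rw [hJdef, ← integral_const_mul]
    refine (abs_integral_le_integral_abs (by norm_num)).trans ?_
    refine integral_mono_on_of_le_Ioo (by norm_num)
      ((hR.mul l.continuous).abs.intervalIntegrable _ _)
      ((continuous_const.mul l.continuous.abs).intervalIntegrable _ _) fun t ht => ?_
    rw [abs_mul]
    exact mul_le_mul_of_nonneg_right (hB t ht) (abs_nonneg _)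
  rw [div_mul_eq_mul_div, le_div_iff₀ (abs_pos.mpr hI), ← abs_mul,
    eq_neg_of_add_eq_zero_left h1, abs_neg, mul_comm J B]
  exact h2

theorem exists_bound_at_roots {n : ℕ} (hn : 1 ≤ n) :
    ∃ K : ℝ, 0 ≤ K ∧ ∀ s : ℝ, (rodriguesPoly n).eval s = 0 →
      ∀ D : Polynomial ℝ, D.natDegree ≤ n → ∀ R : ℝ → ℝ, Continuous R →
      ∀ B : ℝ, 0 ≤ B → (∀ t ∈ Set.Ioo (-1 : ℝ) 1, |R t| ≤ B) →
      (∀ q : Polynomial ℝ, q.natDegree < n →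
        ∫ t in (-1 : ℝ)..1, (D.eval t + R t) * q.eval t = 0) →
      |D.eval s| ≤ K * B := by
  choose! κ hκ0 hκ using fun s (hs : (rodriguesPoly n).eval s = 0) => exists_bound_at_root hn hs
  have hroot : ∀ s, s ∈ (rodriguesPoly n).roots.toFinset ↔ (rodriguesPoly n).eval s = 0 := by
    intro s
    rw [Multiset.mem_toFinset, Polynomial.mem_roots (rodriguesPoly_ne_zero n),
      Polynomial.IsRoot.def]
  have hnn : ∀ s ∈ (rodriguesPoly n).roots.toFinset, 0 ≤ κ s :=
    fun s hs => hκ0 s ((hroot s).mp hs)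
  refine ⟨∑ s ∈ (rodriguesPoly n).roots.toFinset, κ s, Finset.sum_nonneg hnn, ?_⟩
  intro s hs D hD R hR B hB0 hB horth
  exact (hκ s hs D hD R hR B hB horth).trans (mul_le_mul_of_nonneg_right
    (Finset.single_le_sum hnn ((hroot s).mpr hs)) hB0)

theorem exists_taylor_polynomial {n : ℕ} {w : ℝ → ℝ} (hw : ContDiff ℝ (n + 1) w)
    {l r g M : ℝ} (hg : g ∈ Set.Ioo l r)
    (hM : ∀ y ∈ Set.Ioo l r, |iteratedDeriv (n + 1) w y| ≤ M) :
    ∃ T : Polynomial ℝ, T.natDegree ≤ n ∧ T.eval g = w g ∧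
      ∀ t ∈ Set.Ioo l r, |w t - T.eval t| ≤ M * (r - l) ^ (n + 1) := by
  refine ⟨∑ i ∈ Finset.range (n + 1), Polynomial.C ((i.factorial : ℝ)⁻¹ * iteratedDeriv i w g) *
    (Polynomial.X - Polynomial.C g) ^ i, ?_, ?_, fun t ht => ?_⟩
  · refine Polynomial.natDegree_sum_le_of_forall_le _ _ fun i hi => ?_
    refine (Polynomial.natDegree_C_mul_le _ _).trans ?_
    rw [Polynomial.natDegree_pow, Polynomial.natDegree_X_sub_C]
    have := Finset.mem_range.mp hi
    omega
  · rw [Polynomial.eval_finsetSum, Finset.sum_eq_single 0]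
    · simp
    · intro i _ hi
      simp [hi]
    · simp
  · have hM0 : 0 ≤ M := (abs_nonneg _).trans (hM g hg)
    have hlr : 0 < r - l := sub_pos.mpr (hg.1.trans hg.2)
    rcases eq_or_ne g t with rfl | hne
    · rw [Polynomial.eval_finsetSum, Finset.sum_eq_single 0]
      · simp only [Polynomial.eval_C, pow_zero,
          Nat.factorial_zero, Nat.cast_one, inv_one, one_mul, iteratedDeriv_zero, mul_one,
          sub_self, abs_zero]
        positivity
      · intro i _ hi
        simp [hi]
      · simp
    · obtain ⟨y, hy, hyt⟩ :=
        taylor_mean_remainder_lagrange_iteratedDeriv hne hw.contDiffOn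
      have hT : taylorWithinEval w n (Set.uIcc g t) g t
          = (∑ i ∈ Finset.range (n + 1),
            Polynomial.C ((i.factorial : ℝ)⁻¹ * iteratedDeriv i w g) *
              (Polynomial.X - Polynomial.C g) ^ i).eval t := by
        rw [taylor_within_apply, Polynomial.eval_finsetSum]
        refine Finset.sum_congr rfl fun i hi => ?_
        have hi' : (i : WithTop ℕ∞) ≤ n + 1 := by
          exact_mod_cast (Finset.mem_range.mp hi).le
        rw [iteratedDerivWithin_eq_iteratedDeriv (uniqueDiffOn_uIcc hne)
          (hw.of_le hi').contDiffAt Set.left_mem_uIcc]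
        simp
        ring
      have hyI : y ∈ Set.Ioo l r :=
        ⟨(lt_min hg.1 ht.1).trans hy.1, hy.2.trans (max_lt hg.2 ht.2)⟩
      rw [← hT, hyt, abs_div, abs_mul, abs_pow, Nat.abs_cast]
      have htg : |t - g| ≤ r - l := by
        rw [abs_le]
        constructor <;> linarith [hg.1, hg.2, ht.1, ht.2]
      refine (div_le_self (by positivity) ?_).trans ?_
      · exact_mod_cast Nat.one_le_iff_ne_zero.mpr (Nat.factorial_ne_zero _)
      · exact mul_le_mul (hM y hyI) (pow_le_pow_left₀ (abs_nonneg _) htg _) (by positivity) hM0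

/-- Superconvergence of the `L²`-projection onto polynomials of degree less than `n` at the
Gauss points of an interval. -/
theorem exists_projection_gauss_bound {n : ℕ} (hn : 1 ≤ n) :
    ∃ K : ℝ, 0 ≤ K ∧ ∀ l r : ℝ, l < r → ∀ w : ℝ → ℝ, ContDiff ℝ (n + 1) w →
      ∀ q : Polynomial ℝ, q.natDegree ≤ n →
      (∀ v : Polynomial ℝ, v.natDegree < n → ∫ t in l..r, (w t - q.eval t) * v.eval t = 0) →
      ∀ M : ℝ, (∀ y ∈ Set.Ioo l r, |iteratedDeriv (n + 1) w y| ≤ M) →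
      ∀ s ∈ Set.Ioo (-1 : ℝ) 1, legendre n s = 0 →
        |w (affMap l r s) - q.eval (affMap l r s)| ≤ K * (M * (r - l) ^ (n + 1)) := by
  obtain ⟨K, hK, hbound⟩ := exists_bound_at_roots hn
  refine ⟨K, hK, fun l r hlr w hw q hq horth M hM s hs hroot => ?_⟩
  have haff : ∀ t ∈ Set.Ioo (-1 : ℝ) 1, affMap l r t ∈ Set.Ioo l r := by
    intro t ht
    unfold affMap
    constructor <;> nlinarith [ht.1, ht.2]
  obtain ⟨T, hTdeg, hTg, hTb⟩ := exists_taylor_polynomial hw (haff s hs) hM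
  set A : Polynomial ℝ :=
    Polynomial.C ((r - l) / 2) * Polynomial.X + Polynomial.C ((l + r) / 2) with hA
  have hAe : ∀ t, A.eval t = affMap l r t := by
    intro t
    simp only [hA, affMap, Polynomial.eval_add, Polynomial.eval_mul, Polynomial.eval_C,
      Polynomial.eval_X]
    ring
  have hAdeg : A.natDegree ≤ 1 := Polynomial.natDegree_linear_le
  have hcomp : ((T - q).comp A).natDegree ≤ n := by
    refine Polynomial.natDegree_comp_le.trans ?_
    exact (Nat.mul_le_mul (Polynomial.natDegree_sub_le_of_le hTdeg hq) hAdeg).trans (by simp)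
  have hM0 : 0 ≤ M := (abs_nonneg _).trans (hM _ (haff s hs))
  have hlr' : 0 < r - l := sub_pos.mpr hlr
  have hAc : Continuous (affMap l r) := by
    unfold affMap
    fun_prop
  have key := hbound s ((legendre_eq_zero_iff n s).mp hroot) ((T - q).comp A) hcomp
    (fun t => w (affMap l r t) - T.eval (affMap l r t))
    ((hw.continuous.comp hAc).sub (T.continuous.comp hAc)) (M * (r - l) ^ (n + 1))
    (by positivity) (fun t ht => hTb _ (haff t ht)) ?_
  · rwa [Polynomial.eval_comp, hAe, Polynomial.eval_sub, hTg] at key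
  · intro v hv
    set A' : Polynomial ℝ :=
      Polynomial.C (2 / (r - l)) * Polynomial.X + Polynomial.C (-(l + r) / (r - l)) with hA'
    have hv' : (v.comp A').natDegree < n := by
      refine lt_of_le_of_lt Polynomial.natDegree_comp_le ?_
      exact lt_of_le_of_lt (Nat.mul_le_mul_left _ Polynomial.natDegree_linear_le) (by simpa)
    have hinv : ∀ t, A'.eval ((r - l) / 2 * t + (l + r) / 2) = t := by
      intro t
      simp only [hA', Polynomial.eval_add, Polynomial.eval_mul, Polynomial.eval_C,
        Polynomial.eval_X]
      field_simp
      ring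
    have hsub := integral_comp_mul_add (a := (-1 : ℝ)) (b := 1)
      (fun t => (w t - q.eval t) * (v.comp A').eval t)
      (c := (r - l) / 2) (by positivity) ((l + r) / 2)
    rw [show (r - l) / 2 * -1 + (l + r) / 2 = l by ring,
      show (r - l) / 2 * 1 + (l + r) / 2 = r by ring, horth _ hv', smul_zero] at hsub
    rw [← hsub]
    refine integral_congr fun t _ => ?_
    have ht : affMap l r t = (r - l) / 2 * t + (l + r) / 2 := by
      unfold affMap
      ring
    simp only [Polynomial.eval_comp, hAe, Polynomial.eval_sub, hinv, ht]
    ring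

/-- Superconvergence of the second derivative of the truncated Jacobi projection at the
Gauss points (images of the roots of `L_{k-1}`): `(u - u_I)''` is `O(h^k)` there. -/
theorem truncated_jacobi_projection_superconvergence_gauss_points (k : ℕ) (hk : 3 ≤ k) :
    ∃ C > 0, ∀ (a b : ℝ), a < b → ∀ (N : ℕ) (x : ℕ → ℝ) (h : ℝ),
      IsMesh a b N x → IsMeshSize N x h →
      ∀ u : ℝ → ℝ, ContDiff ℝ (k + 2) u →
      ∀ p : ℕ → Polynomial ℝ, (∀ i ∈ Finset.Icc 1 N, IsElemProj k u (x (i - 1)) (x i) (p i)) →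
      ∀ i ∈ Finset.Icc 1 N, ∀ M : ℝ,
        (∀ y ∈ Set.Ioo (x (i - 1)) (x i), |iteratedDeriv (k + 2) u y| ≤ M) →
        ∀ s ∈ Set.Ioo (-1 : ℝ) 1, legendre (k - 1) s = 0 →
          |iteratedDeriv 2 u (affMap (x (i - 1)) (x i) s)
              - (Polynomial.derivative (Polynomial.derivative (p i))).eval
                  (affMap (x (i - 1)) (x i) s)|
            ≤ C * h ^ k * M := by
  obtain ⟨K, hK, hbound⟩ := exists_projection_gauss_bound (n := k - 1) (by omega)
  refine ⟨K + 1, by positivity, ?_⟩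
  intro a b _ N x h hmesh hsize u hu p hp i hi M hM s hs hroot
  obtain ⟨hi1, hiN⟩ := Finset.mem_Icc.mp hi
  obtain ⟨hdeg, -, -, -, -, horth⟩ := hp i hi
  have hlt : x (i - 1) < x i := by
    have := hmesh.2.2.2 (i - 1) (by omega)
    rwa [Nat.sub_add_cancel hi1] at this
  have hk1 : k - 1 + 1 = k := by omega
  have hder : iteratedDeriv (k - 1 + 1) (iteratedDeriv 2 u) = iteratedDeriv (k + 2) u := by
    rw [hk1]
    simp only [iteratedDeriv_eq_iterate, ← Function.iterate_add_apply]
  have hw : ContDiff ℝ ((k - 1 : ℕ) + 1) (iteratedDeriv 2 u) := by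
    have : (((k - 1 : ℕ) : WithTop ℕ∞) + 1) = (k : WithTop ℕ∞) := by exact_mod_cast hk1
    rw [this, iteratedDeriv_eq_iterate]
    exact hu.iterate_deriv' k 2
  have hd2 : (Polynomial.derivative (Polynomial.derivative (p i))).natDegree ≤ k - 1 := by
    have h1 := Polynomial.natDegree_derivative_le (p i)
    have h2 := Polynomial.natDegree_derivative_le (Polynomial.derivative (p i))
    omega
  have key := hbound _ _ hlt _ hw _ hd2 (fun v hv => horth v (by omega)) M
    (by rwa [hder]) s hs hroot
  rw [hk1] at key
  have hM0 : 0 ≤ M :=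
    (abs_nonneg _).trans (hM _ (show (x (i - 1) + x i) / 2 ∈ _ from ⟨by linarith, by linarith⟩))
  have hpow : (x i - x (i - 1)) ^ k ≤ h ^ k :=
    pow_le_pow_left₀ (sub_pos.mpr hlt).le (hsize.1 i hi) k
  have hh : 0 ≤ h ^ k := (pow_nonneg (sub_pos.mpr hlt).le k).trans hpow
  calc _ ≤ K * (M * (x i - x (i - 1)) ^ k) := key
    _ ≤ K * (M * h ^ k) := by gcongr
    _ ≤ (K + 1) * h ^ k * M := by nlinarith [mul_nonneg hh hM0]
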